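/- Let q be a prime power and m ≥ 4 an even integer. Then (q^m - q^(m-1) - q^(m-2) - 1)/(q+1) is a q-cyclotomic coset leader modulo n = (q^m - 1)/(q+1). -/

import Mathlib

theorem exists_dvd_mul_pow_add (q k n r d : ℕ) (hd : d + q ^ k = n) (hr : q ^ (k + 1) = n + r)
    (hr0 : 0 < r) (hrk : r ≤ q ^ k) (hq : 0 < q) (hqr : q * r = n + 1) (j : ℕ) :
    ∃ e, n ∣ d * q ^ j + e ∧ 0 < e ∧ e ≤ q ^ k ∧ (e = r ∨ ∃ i ≤ k, e = q ^ i) := by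
  induction j with
  | zero => exact ⟨q ^ k, by simp [hd], by positivity, le_rfl, .inr ⟨k, le_rfl, rfl⟩⟩
  | succ j ih =>
    obtain ⟨e, hdvd, he0, hek, he⟩ := ih
    have hstep : n ∣ d * q ^ (j + 1) + q * e := by
      have h : d * q ^ (j + 1) + q * e = (d * q ^ j + e) * q := by ring
      exact h ▸ hdvd.mul_right q
    have hreduce (e' : ℕ) (h : q * e = n + e') : n ∣ d * q ^ (j + 1) + e' := by
      rw [h, add_left_comm] at hstep
      exact (Nat.dvd_add_right (dvd_refl n)).1 hstep
    rcases he with rfl | ⟨i, hi, rfl⟩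
    · exact ⟨1, hreduce 1 hqr, one_pos, Nat.one_le_pow _ _ hq, .inr ⟨0, k.zero_le, by simp⟩⟩
    · rcases hi.eq_or_lt with rfl | hi
      · exact ⟨r, hreduce r (by rw [← hr]; ring), hr0, hrk, .inl rfl⟩
      · refine ⟨q ^ (i + 1), ?_, by positivity, Nat.pow_le_pow_right hq hi, .inr ⟨i + 1, hi, rfl⟩⟩
        rwa [pow_succ' q i]

theorem sub_le_mod_of_dvd_add {n x e c : ℕ} (h : n ∣ x + e) (he0 : 0 < e) (hec : e ≤ c)
    (hcn : c < n) : n - c ≤ x % n := by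
  have h' : n ∣ x % n + e := by
    rw [Nat.dvd_iff_mod_eq_zero] at h ⊢
    simpa using h
  have := Nat.le_of_dvd (by omega) h'
  omega

theorem stmt_7 (q m : ℕ) (hq : IsPrimePow q) (hm : 4 ≤ m) (hme : Even m) :
    ∀ j : ℕ,
      (q ^ m - q ^ (m - 1) - q ^ (m - 2) - 1) / (q + 1) ≤
        ((q ^ m - q ^ (m - 1) - q ^ (m - 2) - 1) / (q + 1) * q ^ j) %
          ((q ^ m - 1) / (q + 1)) := by
  intro j
  have hq2 : 2 ≤ q := hq.two_le
  obtain ⟨k, rfl⟩ : ∃ k, m = k + 2 := ⟨m - 2, by omega⟩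
  have hdvd : q + 1 ∣ q ^ (k + 2) - 1 := by
    obtain ⟨t, ht⟩ := hme
    have h1 : q ^ 2 - 1 ∣ (q ^ 2) ^ t - 1 := by simpa using Nat.sub_dvd_pow_sub_pow (q ^ 2) 1 t
    rw [ht, ← two_mul, pow_mul]
    exact (Dvd.intro _ (by simpa using (Nat.sq_sub_sq q 1).symm)).trans h1
  obtain ⟨n, hn⟩ := hdvd
  have hk : 4 ≤ q ^ k := calc
    4 = 2 ^ 2 := by norm_num
    _ ≤ q ^ 2 := Nat.pow_le_pow_left hq2 2
    _ ≤ q ^ k := Nat.pow_le_pow_right (by omega) (by omega)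
  have e1 : q ^ (k + 1) = q * q ^ k := pow_succ' q k
  have e2 : q ^ (k + 2) = q * (q * q ^ k) := by ring
  have hpos : 0 < q ^ (k + 2) := by positivity
  have hn1 : q ^ (k + 2) = (q + 1) * n + 1 := by omega
  have hkn : q ^ k < n := by
    by_contra! h
    nlinarith [Nat.mul_le_mul_left (q + 1) h, Nat.mul_le_mul_right (q * q ^ k) hq2,
      Nat.mul_le_mul_right (q ^ k) hq2]
  have hnk : n < q ^ (k + 1) := by
    by_contra! h
    nlinarith [Nat.mul_le_mul_left (q + 1) h]
  obtain ⟨r, hr⟩ := Nat.exists_eq_add_of_lt hnk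
  have hqr : q * (r + 1) = n + 1 := by nlinarith
  have hrk : r + 1 ≤ q ^ k := by
    by_contra! h
    nlinarith [Nat.mul_le_mul_left (q + 1) (Nat.succ_le_of_lt h)]
  have hnum : q ^ (k + 2) - q ^ (k + 2 - 1) - q ^ (k + 2 - 2) - 1 = (q + 1) * (n - q ^ k) := by
    have h : (q + 1) * (n - q ^ k) + (q * q ^ k + q ^ k) = (q + 1) * n := by
      rw [← Nat.succ_mul, ← Nat.mul_add, Nat.sub_add_cancel hkn.le]
    rw [show k + 2 - 1 = k + 1 by omega, show k + 2 - 2 = k by omega, e1]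
    omega
  rw [hnum, hn, Nat.mul_div_cancel_left _ (Nat.succ_pos q), Nat.mul_div_cancel_left _ q.succ_pos]
  obtain ⟨e, hdvd, he0, hek, -⟩ := exists_dvd_mul_pow_add q k n (r + 1) (n - q ^ k)
    (Nat.sub_add_cancel hkn.le) hr r.succ_pos hrk (by omega) hqr j
  exact sub_le_mod_of_dvd_add hdvd he0 hek hkn
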